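/- arXiv:1506.04337 — 2 statements merged into one kernel-verified Lean document; each statement's English description precedes it below -/
import Mathlib

section
/- Let a₁, a₂, a₃, a₄, a₅ be nonnegative real numbers and let c be a real number with J₁ = 2c. Then J₃ ≤ (16/25)c³, and consequently c³ + J₃ ≤ (41/25)c³. -/
/-- If `a₁,…,a₅ ≥ 0` and `J₁ = 2c`, then `J₃ ≤ (16/25)c³` and hence
`c³ + J₃ ≤ (41/25)c³`. -/
theorem J3_bound (a1 a2 a3 a4 a5 c : ℝ)
    (h1 : 0 ≤ a1) (h2 : 0 ≤ a2) (h3 : 0 ≤ a3) (h4 : 0 ≤ a4) (h5 : 0 ≤ a5)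
    (hc : (a1 + a2 + a3 + a4 + a5) = 2 * c) :
    (a1*a2*a3 + a1*a2*a4 + a1*a2*a5 + a1*a3*a4 + a1*a3*a5 + a1*a4*a5 + a2*a3*a4 + a2*a3*a5 + a2*a4*a5 + a3*a4*a5) ≤ 16 / 25 * c ^ 3 ∧
    c ^ 3 + (a1*a2*a3 + a1*a2*a4 + a1*a2*a5 + a1*a3*a4 + a1*a3*a5 + a1*a4*a5 + a2*a3*a4 + a2*a3*a5 + a2*a4*a5 + a3*a4*a5) ≤ 41 / 25 * c ^ 3 := by
  have hcc : c = (a1 + a2 + a3 + a4 + a5) / 2 := by linarith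
  have key : (a1*a2*a3 + a1*a2*a4 + a1*a2*a5 + a1*a3*a4 + a1*a3*a5 + a1*a4*a5 + a2*a3*a4 + a2*a3*a5 + a2*a4*a5 + a3*a4*a5) ≤ 16 / 25 * c ^ 3 := by
    subst hcc
    linarith [
      mul_nonneg (add_nonneg h1 h2) (sq_nonneg (a1 - a2)),
      mul_nonneg h3 (sq_nonneg (a1 - a2)),
      mul_nonneg h4 (sq_nonneg (a1 - a2)),
      mul_nonneg h5 (sq_nonneg (a1 - a2)),
      mul_nonneg (add_nonneg h1 h3) (sq_nonneg (a1 - a3)),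
      mul_nonneg h2 (sq_nonneg (a1 - a3)),
      mul_nonneg h4 (sq_nonneg (a1 - a3)),
      mul_nonneg h5 (sq_nonneg (a1 - a3)),
      mul_nonneg (add_nonneg h1 h4) (sq_nonneg (a1 - a4)),
      mul_nonneg h2 (sq_nonneg (a1 - a4)),
      mul_nonneg h3 (sq_nonneg (a1 - a4)),
      mul_nonneg h5 (sq_nonneg (a1 - a4)),
      mul_nonneg (add_nonneg h1 h5) (sq_nonneg (a1 - a5)),
      mul_nonneg h2 (sq_nonneg (a1 - a5)),
      mul_nonneg h3 (sq_nonneg (a1 - a5)),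
      mul_nonneg h4 (sq_nonneg (a1 - a5)),
      mul_nonneg (add_nonneg h2 h3) (sq_nonneg (a2 - a3)),
      mul_nonneg h1 (sq_nonneg (a2 - a3)),
      mul_nonneg h4 (sq_nonneg (a2 - a3)),
      mul_nonneg h5 (sq_nonneg (a2 - a3)),
      mul_nonneg (add_nonneg h2 h4) (sq_nonneg (a2 - a4)),
      mul_nonneg h1 (sq_nonneg (a2 - a4)),
      mul_nonneg h3 (sq_nonneg (a2 - a4)),
      mul_nonneg h5 (sq_nonneg (a2 - a4)),
      mul_nonneg (add_nonneg h2 h5) (sq_nonneg (a2 - a5)),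
      mul_nonneg h1 (sq_nonneg (a2 - a5)),
      mul_nonneg h3 (sq_nonneg (a2 - a5)),
      mul_nonneg h4 (sq_nonneg (a2 - a5)),
      mul_nonneg (add_nonneg h3 h4) (sq_nonneg (a3 - a4)),
      mul_nonneg h1 (sq_nonneg (a3 - a4)),
      mul_nonneg h2 (sq_nonneg (a3 - a4)),
      mul_nonneg h5 (sq_nonneg (a3 - a4)),
      mul_nonneg (add_nonneg h3 h5) (sq_nonneg (a3 - a5)),
      mul_nonneg h1 (sq_nonneg (a3 - a5)),
      mul_nonneg h2 (sq_nonneg (a3 - a5)),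
      mul_nonneg h4 (sq_nonneg (a3 - a5)),
      mul_nonneg (add_nonneg h4 h5) (sq_nonneg (a4 - a5)),
      mul_nonneg h1 (sq_nonneg (a4 - a5)),
      mul_nonneg h2 (sq_nonneg (a4 - a5)),
      mul_nonneg h3 (sq_nonneg (a4 - a5))]
  exact ⟨key, by linarith⟩
end

section
/- Let a₁, a₂, a₃, a₄, a₅ be nonnegative real numbers, let π be a real number, and let c > 0 be a real number, such that 8I₃ − 6I₂I₁ + I₁³ = 24π and I₁ = 2c. Then J₂ ≤ (41/25)c² − π/c. -/
/-- If `a₁,…,a₅ ≥ 0`, `c > 0`, `8I₃ − 6I₂I₁ + I₁³ = 24π` and `I₁ = 2c`, then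
`J₂ ≤ (41/25)c² − π/c`. -/
theorem J2_upper_bound (a1 a2 a3 a4 a5 π c : ℝ)
    (h1 : 0 ≤ a1) (h2 : 0 ≤ a2) (h3 : 0 ≤ a3) (h4 : 0 ≤ a4) (h5 : 0 ≤ a5)
    (hc : 0 < c)
    (hI : 8 * (a1^3 + a2^3 + a3^3 + a4^3 + a5^3) - 6 * (a1^2 + a2^2 + a3^2 + a4^2 + a5^2) * (a1 + a2 + a3 + a4 + a5) + (a1 + a2 + a3 + a4 + a5) ^ 3 = 24 * π)
    (hI1 : (a1 + a2 + a3 + a4 + a5) = 2 * c) :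
    (a1*a2 + a1*a3 + a1*a4 + a1*a5 + a2*a3 + a2*a4 + a2*a5 + a3*a4 + a3*a5 + a4*a5) ≤ 41 / 25 * c ^ 2 - π / c := by
  have hpi : π = c^3 - c*(a1*a2 + a1*a3 + a1*a4 + a1*a5 + a2*a3 + a2*a4 + a2*a5 + a3*a4 + a3*a5 + a4*a5) + (a1*a2*a3 + a1*a2*a4 + a1*a2*a5 + a1*a3*a4 + a1*a3*a5 + a1*a4*a5 + a2*a3*a4 + a2*a3*a5 + a2*a4*a5 + a3*a4*a5) := by
    have hcs : c = (a1 + a2 + a3 + a4 + a5) / 2 := by linarith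
    rw [hcs]
    linarith [hI]
  have hA : 5*(a1*a2 + a1*a3 + a1*a4 + a1*a5 + a2*a3 + a2*a4 + a2*a5 + a3*a4 + a3*a5 + a4*a5) ≤ 2*(a1 + a2 + a3 + a4 + a5)^2 := by
    linarith [sq_nonneg (a1-a2), sq_nonneg (a1-a3), sq_nonneg (a1-a4), sq_nonneg (a1-a5), sq_nonneg (a2-a3), sq_nonneg (a2-a4), sq_nonneg (a2-a5), sq_nonneg (a3-a4), sq_nonneg (a3-a5), sq_nonneg (a4-a5)]
  have hB : 5*(a1*a2*a3 + a1*a2*a4 + a1*a2*a5 + a1*a3*a4 + a1*a3*a5 + a1*a4*a5 + a2*a3*a4 + a2*a3*a5 + a2*a4*a5 + a3*a4*a5) ≤ (a1 + a2 + a3 + a4 + a5)*(a1*a2 + a1*a3 + a1*a4 + a1*a5 + a2*a3 + a2*a4 + a2*a5 + a3*a4 + a3*a5 + a4*a5) := by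
    linarith [mul_nonneg h1 (sq_nonneg (a2-a3)), mul_nonneg h1 (sq_nonneg (a2-a4)), mul_nonneg h1 (sq_nonneg (a2-a5)), mul_nonneg h1 (sq_nonneg (a3-a4)), mul_nonneg h1 (sq_nonneg (a3-a5)), mul_nonneg h1 (sq_nonneg (a4-a5)),
      mul_nonneg h2 (sq_nonneg (a1-a3)), mul_nonneg h2 (sq_nonneg (a1-a4)), mul_nonneg h2 (sq_nonneg (a1-a5)), mul_nonneg h2 (sq_nonneg (a3-a4)), mul_nonneg h2 (sq_nonneg (a3-a5)), mul_nonneg h2 (sq_nonneg (a4-a5)),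
      mul_nonneg h3 (sq_nonneg (a1-a2)), mul_nonneg h3 (sq_nonneg (a1-a4)), mul_nonneg h3 (sq_nonneg (a1-a5)), mul_nonneg h3 (sq_nonneg (a2-a4)), mul_nonneg h3 (sq_nonneg (a2-a5)), mul_nonneg h3 (sq_nonneg (a4-a5)),
      mul_nonneg h4 (sq_nonneg (a1-a2)), mul_nonneg h4 (sq_nonneg (a1-a3)), mul_nonneg h4 (sq_nonneg (a1-a5)), mul_nonneg h4 (sq_nonneg (a2-a3)), mul_nonneg h4 (sq_nonneg (a2-a5)), mul_nonneg h4 (sq_nonneg (a3-a5)),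
      mul_nonneg h5 (sq_nonneg (a1-a2)), mul_nonneg h5 (sq_nonneg (a1-a3)), mul_nonneg h5 (sq_nonneg (a1-a4)), mul_nonneg h5 (sq_nonneg (a2-a3)), mul_nonneg h5 (sq_nonneg (a2-a4)), mul_nonneg h5 (sq_nonneg (a3-a4))]
  rw [hI1] at hA hB
  have hC := mul_le_mul_of_nonneg_left hA hc.le
  have hD : π / c ≤ 41 / 25 * c ^ 2 - (a1*a2 + a1*a3 + a1*a4 + a1*a5 + a2*a3 + a2*a4 + a2*a5 + a3*a4 + a3*a5 + a4*a5) := by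
    rw [div_le_iff₀ hc, hpi]
    linarith
  linarith
end
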